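/- arXiv:2501.07282 — 2 statements merged into one kernel-verified Lean document; each statement's English description precedes it below -/
import Mathlib

section
/- Let G be a countable discrete amenable group, (V,‖·‖) a semi-normed real vector space, and π: G → Isom(V) a uniformly bounded representation. For v ∈ V, v belongs to the ‖·‖-closure of L = span{u − π(g)u : u ∈ V, g ∈ G} if and only if limsup_{F→G} ‖A_F v‖ = 0. -/
open scoped Pointwise
open Filter

/-- The collection `F(G)` of non-empty finite subsets of `G`. -/
def FinG (G : Type*) := {F : Finset G // F.Nonempty}

section Defs

variable {G : Type*} [Group G] [DecidableEq G]

/-- `F` is `(K, δ)`-invariant: `|KF Δ F| ≤ δ|F|`. -/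
def IsInv (K : Finset G) (δ : ℝ) (F : Finset G) : Prop :=
  ((symmDiff (K * F) F).card : ℝ) ≤ δ * (F.card : ℝ)

/-- `G` is amenable: for every `(K, δ)` there is a `(K, δ)`-invariant nonempty finite set. -/
def AmenableG (G : Type*) [Group G] [DecidableEq G] : Prop :=
  ∀ K : Finset G, K.Nonempty → ∀ δ : ℝ, 0 < δ →
    ∃ F : Finset G, F.Nonempty ∧ IsInv K δ F

/-- `limsup_{F → G} φ(F) = inf_{(K,δ)} sup {φ(F) : F is (K,δ)-invariant}` (in the extended reals). -/
noncomputable def limsupG (φ : FinG G → ℝ) : EReal :=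
  ⨅ (K : {K : Finset G // K.Nonempty}) (δ : {d : ℝ // 0 < d}),
    ⨆ F : {F : FinG G // IsInv K.1 δ.1 F.1}, (φ F.1 : EReal)

/-- `liminf_{F → G} φ(F) = sup_{(K,δ)} inf {φ(F) : F is (K,δ)-invariant}` (in the extended reals). -/
noncomputable def liminfG (φ : FinG G → ℝ) : EReal :=
  ⨆ (K : {K : Finset G // K.Nonempty}) (δ : {d : ℝ // 0 < d}),
    ⨅ F : {F : FinG G // IsInv K.1 δ.1 F.1}, (φ F.1 : EReal)

/-- `lim_{F → G} φ(F) = L`. -/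
def TendstoG (φ : FinG G → ℝ) (L : ℝ) : Prop :=
  ∀ ε : ℝ, 0 < ε → ∃ (K : Finset G) (δ : ℝ), K.Nonempty ∧ 0 < δ ∧
    ∀ F : FinG G, IsInv K δ F.1 → |φ F - L| < ε

/-- A (left) Følner sequence: `|F_n Δ g F_n| / |F_n| → 0` for every `g ∈ G`. -/
def FolnerSeq (F : ℕ → FinG G) : Prop :=
  ∀ g : G, Filter.Tendsto
    (fun n => ((symmDiff ((F n).1.image (fun h => g * h)) (F n).1).card : ℝ) / ((F n).1.card : ℝ))
    Filter.atTop (nhds (0 : ℝ))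

variable {V : Type*} [SeminormedAddCommGroup V] [NormedSpace ℝ V]

/-- The representation `π` is uniformly bounded with constant `C`. -/
def UnifBdd (π : G →* (V ≃L[ℝ] V)) (C : ℝ) : Prop :=
  ∀ (g : G) (v : V), ‖π g v‖ ≤ C * ‖v‖

/-- The representation `π` is isometric (`C_π = 1`). -/
def IsIsometric (π : G →* (V ≃L[ℝ] V)) : Prop :=
  ∀ (g : G) (v : V), ‖π g v‖ = ‖v‖

/-- The ergodic sum `S_F v = Σ_{g ∈ F} π(g⁻¹) v`. -/
noncomputable def SF (π : G →* (V ≃L[ℝ] V)) (F : Finset G) (v : V) : V :=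
  ∑ g ∈ F, π g⁻¹ v

/-- The ergodic average `A_F v = |F|⁻¹ • S_F v`. -/
noncomputable def AF (π : G →* (V ≃L[ℝ] V)) (F : Finset G) (v : V) : V :=
  (F.card : ℝ)⁻¹ • SF π F v

/-- Right translation `g • F = F g⁻¹` on nonempty finite subsets. -/
def rT (g : G) (F : FinG G) : FinG G :=
  ⟨F.1.image (fun h => h * g⁻¹), F.2.image (fun h => h * g⁻¹)⟩

/-- `G`-equivariance of a set map: `π(g) φ(F) = φ(F g⁻¹)`. -/
def IsEquivariant (π : G →* (V ≃L[ℝ] V)) (φ : FinG G → V) : Prop :=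
  ∀ (g : G) (F : FinG G), π g (φ F) = φ (rT g F)

/-- Boundedness of a set map: `sup_F ‖φ(F)‖/|F| < ∞`. -/
def IsBddMap (φ : FinG G → V) : Prop :=
  ∃ C : ℝ, ∀ F : FinG G, ‖φ F‖ ≤ C * (F.1.card : ℝ)

/-- Membership in the space `M` of bounded `G`-equivariant set maps. -/
def MemM (π : G →* (V ≃L[ℝ] V)) (φ : FinG G → V) : Prop :=
  IsBddMap φ ∧ IsEquivariant π φ

/-- The sup seminorm `|||φ|||_sup = sup_F ‖φ(F)‖/|F|`. -/
noncomputable def supNorm (φ : FinG G → V) : ℝ :=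
  ⨆ F : FinG G, ‖φ F‖ / (F.1.card : ℝ)

/-- The asymptotic seminorm `|||φ|||_G = limsup_{F → G} ‖φ(F)‖/|F|` (in the extended reals). -/
noncomputable def normG (φ : FinG G → V) : EReal :=
  limsupG (fun F => ‖φ F‖ / (F.1.card : ℝ))

/-- Union of nonempty finite subsets. -/
def unionF (E F : FinG G) : FinG G :=
  ⟨E.1 ∪ F.1, E.2.inl⟩

/-- Additive set maps: `φ(E ⊔ F) = φ(E) + φ(F)` for disjoint `E, F`. -/
def IsAdditiveMap (φ : FinG G → V) : Prop :=
  ∀ E F : FinG G, Disjoint E.1 F.1 → φ (unionF E F) = φ E + φ F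

/-- The additive set map `S(v)(F) = S_F v`. -/
noncomputable def Smap (π : G →* (V ≃L[ℝ] V)) (v : V) : FinG G → V :=
  fun F => SF π F.1 v

/-- The coboundary subspace `L_W = span{w − π(g)w : w ∈ W, g ∈ G}`. -/
def cobSpan (π : G →* (V ≃L[ℝ] V)) (W : Set V) : Submodule ℝ V :=
  Submodule.span ℝ {x | ∃ w ∈ W, ∃ g : G, x = w - π g w}

/-- The coboundary subspace `L = L_V`. -/
def cobL (π : G →* (V ≃L[ℝ] V)) : Submodule ℝ V :=
  cobSpan π Set.univ

/-- The quotient seminorm `‖v + U‖_U = inf_{u ∈ U} ‖v + u‖`. -/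
noncomputable def qnorm (U : Set V) (v : V) : ℝ :=
  ⨅ u : U, ‖v + u.1‖

/-- `v` is an additive realization of `φ`: `lim_{F→G} ‖φ(F)/|F| − A_F v‖ = 0`. -/
def IsRealization (π : G →* (V ≃L[ℝ] V)) (φ : FinG G → V) (v : V) : Prop :=
  TendstoG (fun F => ‖(F.1.card : ℝ)⁻¹ • φ F - AF π F.1 v‖) 0

/-- `φ` is asymptotically additive: `inf_{ψ ∈ M_⊕} |||φ − ψ|||_G = 0`. -/
def AsympAdd (π : G →* (V ≃L[ℝ] V)) (φ : FinG G → V) : Prop :=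
  (⨅ ψ : {ψ : FinG G → V // MemM π ψ ∧ IsAdditiveMap ψ}, normG (φ - ψ.1)) = (0 : EReal)

/-- `φ` is asymptotically additive relative to `W`. -/
def AsympAddRel (π : G →* (V ≃L[ℝ] V)) (W : Set V) (φ : FinG G → V) : Prop :=
  (⨅ w : W, limsupG (fun F => ‖(F.1.card : ℝ)⁻¹ • φ F - AF π F.1 w.1‖)) = (0 : EReal)

/-- The quotient norm on `M_⊕ / N_⊕`. -/
noncomputable def qMplusN (π : G →* (V ≃L[ℝ] V)) (ψ : FinG G → V) : ℝ :=
  ⨅ η : {η : FinG G → V // MemM π η ∧ IsAdditiveMap η ∧ normG η = (0 : EReal)},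
    supNorm (ψ + η.1)

end Defs

section ErgodicAverages

variable {G : Type*} [Group G] {V : Type*} [SeminormedAddCommGroup V] [NormedSpace ℝ V]

theorem AF_add (π : G →* (V ≃L[ℝ] V)) (F : Finset G) (v w : V) :
    AF π F (v + w) = AF π F v + AF π F w := by
  simp [AF, SF, Finset.sum_add_distrib]

theorem AF_smul (π : G →* (V ≃L[ℝ] V)) (F : Finset G) (a : ℝ) (v : V) :
    AF π F (a • v) = a • AF π F v := by
  simp [AF, SF, ← Finset.smul_sum, smul_comm a]

theorem norm_AF_le {π : G →* (V ≃L[ℝ] V)} {C : ℝ} (hπ : UnifBdd π C) {F : Finset G}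
    (hF : F.Nonempty) (v : V) : ‖AF π F v‖ ≤ C * ‖v‖ := by
  have hpos : (0 : ℝ) < F.card := by exact_mod_cast hF.card_pos
  rw [AF, norm_smul, norm_inv, Real.norm_natCast, inv_mul_le_iff₀ hpos]
  refine (norm_sum_le_of_le F fun g _ => hπ g⁻¹ v).trans ?_
  simp

theorem sub_AF_mem_cobL (π : G →* (V ≃L[ℝ] V)) {F : Finset G} (hF : F.Nonempty) (v : V) :
    v - AF π F v ∈ cobL π := by
  have hne : (F.card : ℝ) ≠ 0 := by exact_mod_cast hF.card_pos.ne'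
  have heq : v - AF π F v = (F.card : ℝ)⁻¹ • ∑ g ∈ F, (v - π g⁻¹ v) := by
    rw [Finset.sum_sub_distrib, smul_sub, Finset.sum_const, ← Nat.cast_smul_eq_nsmul ℝ,
      inv_smul_smul₀ hne, AF, SF]
  rw [heq]
  exact Submodule.smul_mem _ _ (Submodule.sum_mem _ fun g _ =>
    Submodule.subset_span ⟨v, Set.mem_univ v, g⁻¹, rfl⟩)

variable [DecidableEq G]

theorem card_smul_sdiff_le_of_isInv {K F : Finset G} {δ : ℝ} (h : IsInv K δ F) {k : G}
    (hk : k ∈ K) : (((k • F) \ F).card : ℝ) ≤ δ * F.card := by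
  refine le_trans ?_ h
  exact_mod_cast Finset.card_le_card fun x hx => by
    obtain ⟨hx, hxF⟩ := Finset.mem_sdiff.1 hx
    exact Finset.mem_symmDiff.2 (Or.inl ⟨Finset.smul_finset_subset_mul hk hx, hxF⟩)

theorem limsupG_nonneg (hG : AmenableG G) {φ : FinG G → ℝ} (hφ : ∀ F, 0 ≤ φ F) :
    0 ≤ limsupG φ := by
  refine le_iInf₂ fun K δ => ?_
  obtain ⟨F, hF, hinv⟩ := hG K.1 K.2 δ.1 δ.2
  exact le_iSup_of_le ⟨⟨F, hF⟩, hinv⟩ (EReal.coe_nonneg.2 (hφ _))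

theorem SF_sub_apply (π : G →* (V ≃L[ℝ] V)) (F : Finset G) (g : G) (u : V) :
    SF π F (u - π g u) = SF π (F \ (g⁻¹ • F)) u - SF π ((g⁻¹ • F) \ F) u := by
  have hsum : ∑ h ∈ F, π h⁻¹ (π g u) = ∑ h ∈ g⁻¹ • F, π h⁻¹ u := by
    rw [← Finset.image_smul, Finset.sum_image (MulAction.injective g⁻¹).injOn]
    simp
    rfl
  simp only [SF, map_sub, Finset.sum_sub_distrib, hsum, Finset.sum_sdiff_sub_sum_sdiff]

theorem norm_AF_sub_apply_le {π : G →* (V ≃L[ℝ] V)} {C : ℝ} (hπ : UnifBdd π C) {F : Finset G}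
    (hF : F.Nonempty) {g : G} {δ : ℝ} (hC : 0 ≤ C)
    (hδ : (((g⁻¹ • F) \ F).card : ℝ) ≤ δ * F.card) (u : V) :
    ‖AF π F (u - π g u)‖ ≤ 2 * δ * (C * ‖u‖) := by
  have hpos : (0 : ℝ) < F.card := by exact_mod_cast hF.card_pos
  have hbound (E : Finset G) : ‖SF π E u‖ ≤ E.card * (C * ‖u‖) := by
    simpa [SF] using norm_sum_le_of_le E fun g _ => hπ g⁻¹ u
  have hcard : (F \ (g⁻¹ • F)).card = ((g⁻¹ • F) \ F).card :=
    Finset.card_sdiff_comm (by simp)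
  rw [AF, norm_smul, norm_inv, Real.norm_natCast, inv_mul_le_iff₀ hpos, SF_sub_apply]
  have h₁ := hbound (F \ (g⁻¹ • F))
  rw [hcard] at h₁
  have h₂ := hbound ((g⁻¹ • F) \ F)
  have h₃ := mul_le_mul_of_nonneg_right hδ (mul_nonneg hC (norm_nonneg u))
  linarith [norm_sub_le (SF π (F \ (g⁻¹ • F)) u) (SF π ((g⁻¹ • F) \ F) u)]

/-- The averages `A_F v` are small along sets almost invariant under finitely many elements. -/
def AFVanishes (π : G →* (V ≃L[ℝ] V)) (v : V) : Prop :=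
  ∀ ε : ℝ, 0 < ε → ∃ (K : Finset G) (δ : ℝ), 0 < δ ∧ ∀ F : Finset G, F.Nonempty →
    (∀ k ∈ K, (((k • F) \ F).card : ℝ) ≤ δ * F.card) → ‖AF π F v‖ ≤ ε

theorem AFVanishes.add {π : G →* (V ≃L[ℝ] V)} {v w : V} (hv : AFVanishes π v)
    (hw : AFVanishes π w) : AFVanishes π (v + w) := by
  intro ε hε
  obtain ⟨K₁, δ₁, hδ₁, h₁⟩ := hv (ε / 2) (half_pos hε)
  obtain ⟨K₂, δ₂, hδ₂, h₂⟩ := hw (ε / 2) (half_pos hε)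
  refine ⟨K₁ ∪ K₂, min δ₁ δ₂, lt_min hδ₁ hδ₂, fun F hF hinv => ?_⟩
  have hv := h₁ F hF fun k hk => (hinv k (Finset.mem_union_left _ hk)).trans
    (by gcongr; exact min_le_left _ _)
  have hw := h₂ F hF fun k hk => (hinv k (Finset.mem_union_right _ hk)).trans
    (by gcongr; exact min_le_right _ _)
  rw [AF_add]
  linarith [norm_add_le (AF π F v) (AF π F w)]

theorem AFVanishes.smul {π : G →* (V ≃L[ℝ] V)} {v : V} (hv : AFVanishes π v) (a : ℝ) :
    AFVanishes π (a • v) := by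
  intro ε hε
  have hpos : 0 < |a| + 1 := by positivity
  obtain ⟨K, δ, hδ, h⟩ := hv (ε / (|a| + 1)) (by positivity)
  refine ⟨K, δ, hδ, fun F hF hinv => ?_⟩
  have hle := (le_div_iff₀ hpos).1 (h F hF hinv)
  rw [AF_smul, norm_smul, Real.norm_eq_abs]
  linarith [norm_nonneg (AF π F v)]

theorem AFVanishes.of_mem_cobL {π : G →* (V ≃L[ℝ] V)} {C : ℝ} (hC : 0 ≤ C) (hπ : UnifBdd π C)
    {v : V} (hv : v ∈ cobL π) : AFVanishes π v := by
  induction hv using Submodule.span_induction with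
  | mem x hx =>
    obtain ⟨u, -, g, rfl⟩ := hx
    intro ε hε
    have hpos : 0 < 2 * (C * ‖u‖ + 1) := by positivity
    refine ⟨{g⁻¹}, ε / (2 * (C * ‖u‖ + 1)), by positivity, fun F hF hinv => ?_⟩
    refine (norm_AF_sub_apply_le hπ hF hC (hinv g⁻¹ (Finset.mem_singleton_self _)) u).trans ?_
    have hε' := div_mul_cancel₀ ε hpos.ne'
    have : 0 < ε / (2 * (C * ‖u‖ + 1)) := by positivity
    linarith
  | zero => exact fun ε hε => ⟨∅, 1, one_pos, fun F _ _ => by simpa [AF, SF] using hε.le⟩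
  | add x y _ _ hx hy => exact hx.add hy
  | smul a x _ hx => exact hx.smul a

theorem AFVanishes.of_mem_closure_cobL {π : G →* (V ≃L[ℝ] V)} {C : ℝ} (hC : 0 ≤ C)
    (hπ : UnifBdd π C) {v : V} (hv : v ∈ closure (cobL π : Set V)) : AFVanishes π v := by
  intro ε hε
  have hpos : 0 < C + 1 := by positivity
  obtain ⟨w, hw, hvw⟩ := Metric.mem_closure_iff.1 hv (ε / 2 / (C + 1)) (by positivity)
  obtain ⟨K, δ, hδ, h⟩ := AFVanishes.of_mem_cobL hC hπ hw (ε / 2) (half_pos hε)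
  refine ⟨K, δ, hδ, fun F hF hinv => ?_⟩
  have hsub := norm_AF_le hπ hF (v - w)
  have hadd := AF_add π F w (v - w)
  rw [add_sub_cancel] at hadd
  rw [dist_eq_norm, lt_div_iff₀ hpos] at hvw
  rw [hadd]
  linarith [norm_add_le (AF π F w) (AF π F (v - w)), h F hF hinv, norm_nonneg (v - w)]

theorem AFVanishes.limsupG_le {π : G →* (V ≃L[ℝ] V)} {v : V} (hv : AFVanishes π v) :
    limsupG (fun F => ‖AF π F.1 v‖) ≤ 0 := by
  refine EReal.le_of_forall_lt_iff_le.1 fun ε hε => ?_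
  obtain ⟨K, δ, hδ, h⟩ := hv ε (EReal.coe_pos.1 hε)
  refine iInf₂_le_of_le ⟨insert 1 K, Finset.insert_nonempty 1 K⟩ ⟨δ, hδ⟩ (iSup_le fun F => ?_)
  exact EReal.coe_le_coe_iff.2 (h F.1.1 F.1.2 fun k hk =>
    card_smul_sdiff_le_of_isInv F.2 (Finset.mem_insert_of_mem hk))

theorem mem_closure_cobL_of_limsupG_le (hG : AmenableG G) {π : G →* (V ≃L[ℝ] V)} {v : V}
    (hv : limsupG (fun F => ‖AF π F.1 v‖) ≤ 0) : v ∈ closure (cobL π : Set V) := by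
  refine Metric.mem_closure_iff.2 fun ε hε => ?_
  obtain ⟨K, hK⟩ := iInf_lt_iff.1 (hv.trans_lt (EReal.coe_pos.2 hε))
  obtain ⟨δ, hδ⟩ := iInf_lt_iff.1 hK
  obtain ⟨F, hF, hinv⟩ := hG K.1 K.2 δ.1 δ.2
  refine ⟨v - AF π F v, sub_AF_mem_cobL π hF v, ?_⟩
  rw [dist_eq_norm, sub_sub_cancel]
  exact EReal.coe_lt_coe_iff.1
    ((le_iSup (fun F : {F : FinG G // IsInv K.1 δ.1 F.1} => ((‖AF π F.1.1 v‖ : ℝ) : EReal))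
      ⟨⟨F, hF⟩, hinv⟩).trans_lt hδ)

end ErgodicAverages

theorem statement5 {G : Type*} [Group G] [DecidableEq G] [Countable G]
    {V : Type*} [SeminormedAddCommGroup V] [NormedSpace ℝ V]
    (hG : AmenableG G) (π : G →* (V ≃L[ℝ] V)) (C : ℝ) (hπ : UnifBdd π C)
    (v : V) :
    v ∈ closure (cobL π : Set V) ↔
      limsupG (fun F => ‖AF π F.1 v‖) = (0 : EReal) := by
  have hπ' : UnifBdd π (max C 0) := fun g u =>
    (hπ g u).trans (mul_le_mul_of_nonneg_right (le_max_left C 0) (norm_nonneg u))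
  exact ⟨fun hv => le_antisymm
    (AFVanishes.of_mem_closure_cobL (le_max_right C 0) hπ' hv).limsupG_le
    (limsupG_nonneg hG fun _ => norm_nonneg _),
    fun h => mem_closure_cobL_of_limsupG_le hG h.le⟩
end

section
/- Let G be a countable discrete amenable group, (V,‖·‖) a complete semi-normed real vector space, and π: G → Isom(V) a uniformly bounded representation. Then the space M of bounded G-equivariant set maps is complete with respect to the semi-norm |||φ|||_G = limsup_{F→G} ‖φ(F)‖/|F|: every |||·|||_G-Cauchy sequence in M has a |||·|||_G-limit in M. -/
open scoped Pointwise
open Filter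

section Completeness

lemma FinG.card_pos {G : Type*} (F : FinG G) : (0 : ℝ) < F.1.card :=
  Nat.cast_pos.2 (Finset.card_pos.2 F.2)

variable {G : Type*} [Group G] [DecidableEq G]

lemma IsInv.of_subset {K K' F : Finset G} {δ δ' : ℝ} (hK' : K'.Nonempty) (hKK' : K' ⊆ K)
    (hδ : δ ≤ δ' / 2) (h : IsInv K δ F) : IsInv K' δ' F := by
  obtain ⟨k, hk⟩ := hK'
  have hsdiff : ((K' * F) \ F).card ≤ (symmDiff (K * F) F).card :=
    Finset.card_le_card fun x hx => by
      rw [Finset.mem_sdiff] at hx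
      exact Finset.mem_symmDiff.2 (Or.inl ⟨Finset.mul_subset_mul_right hKK' hx.1, hx.2⟩)
  have hsdiff' : (F \ (K' * F)).card ≤ (symmDiff (K * F) F).card := by
    have hsub : k • F ⊆ K' * F := Finset.smul_finset_subset_mul hk
    calc (F \ (K' * F)).card ≤ (F \ (k • F)).card :=
          Finset.card_le_card (Finset.sdiff_subset_sdiff subset_rfl hsub)
      _ = ((k • F) \ F).card := Finset.card_sdiff_comm (by simp)
      _ ≤ ((K' * F) \ F).card := Finset.card_le_card (Finset.sdiff_subset_sdiff hsub subset_rfl)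
      _ ≤ _ := hsdiff
  have hunion : (symmDiff (K' * F) F).card ≤ ((K' * F) \ F).card + (F \ (K' * F)).card := by
    rw [symmDiff_def, Finset.sup_eq_union]
    exact Finset.card_union_le _ _
  have htotal : ((symmDiff (K' * F) F).card : ℝ) ≤ 2 * (symmDiff (K * F) F).card := by
    exact_mod_cast (by omega : (symmDiff (K' * F) F).card ≤ 2 * (symmDiff (K * F) F).card)
  have hmul := mul_le_mul_of_nonneg_right hδ (Nat.cast_nonneg F.card : (0 : ℝ) ≤ F.card)
  unfold IsInv at h ⊢
  linarith

/-- The property `p F` holds for all sufficiently invariant `F`. -/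
def EventuallyInv (p : FinG G → Prop) : Prop :=
  ∃ (K : Finset G) (δ : ℝ), K.Nonempty ∧ 0 < δ ∧ ∀ F : FinG G, IsInv K δ F.1 → p F

lemma EventuallyInv.mono {p q : FinG G → Prop} (hp : EventuallyInv p) (h : ∀ F, p F → q F) :
    EventuallyInv q := by
  obtain ⟨K, δ, hK, hδ, hp⟩ := hp
  exact ⟨K, δ, hK, hδ, fun F hF => h F (hp F hF)⟩

lemma EventuallyInv.and {p q : FinG G → Prop} (hp : EventuallyInv p) (hq : EventuallyInv q) :
    EventuallyInv fun F => p F ∧ q F := by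
  obtain ⟨K, δ, hK, hδ, hp⟩ := hp
  obtain ⟨L, η, hL, hη, hq⟩ := hq
  refine ⟨K ∪ L, min δ η / 2, hK.inl, half_pos (lt_min hδ hη), fun F hF => ⟨hp F ?_, hq F ?_⟩⟩
  · exact hF.of_subset hK Finset.subset_union_left
      (div_le_div_of_nonneg_right (min_le_left _ _) zero_le_two)
  · exact hF.of_subset hL Finset.subset_union_right
      (div_le_div_of_nonneg_right (min_le_right _ _) zero_le_two)

lemma EventuallyInv.forall_lt {p : ℕ → FinG G → Prop} (hp : ∀ j, EventuallyInv (p j)) (k : ℕ) :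
    EventuallyInv fun F => ∀ j < k, p j F := by
  induction k with
  | zero => exact (hp 0).mono fun F _ j hj => absurd hj (Nat.not_lt_zero j)
  | succ k ih =>
    refine (ih.and (hp k)).mono fun F hF j hj => ?_
    rcases Nat.lt_succ_iff_lt_or_eq.1 hj with h | rfl
    exacts [hF.1 j h, hF.2]

lemma eventuallyInv_le_card [Infinite G] (k : ℕ) : EventuallyInv fun F : FinG G => k ≤ F.1.card := by
  obtain ⟨K, hK⟩ := Infinite.exists_subset_card_eq G (2 * k + 1)
  refine ⟨K, 1, Finset.card_pos.1 (by omega), one_pos, fun F hF => ?_⟩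
  have hF' : (symmDiff (K * F.1) F.1).card ≤ F.1.card := by
    unfold IsInv at hF
    rw [one_mul] at hF
    exact_mod_cast hF
  have hKF : K.card ≤ (K * F.1).card := Finset.card_le_card_mul_right F.2
  have hsub : K * F.1 ⊆ symmDiff (K * F.1) F.1 ∪ F.1 := fun x hx => by
    by_cases hxF : x ∈ F.1 <;> simp [Finset.mem_symmDiff, hx, hxF]
  have := (Finset.card_le_card hsub).trans (Finset.card_union_le _ _)
  omega

lemma card_rT (g : G) (F : FinG G) : (rT g F).1.card = F.1.card :=
  Finset.card_image_of_injective _ (mul_left_injective g⁻¹)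

lemma isInv_rT {K : Finset G} {δ : ℝ} (g : G) (F : FinG G) :
    IsInv K δ (rT g F).1 ↔ IsInv K δ F.1 := by
  have hinj : Function.Injective fun h : G => h * g⁻¹ := mul_left_injective g⁻¹
  have hmul : K * (rT g F).1 = (K * F.1).image fun h => h * g⁻¹ := by
    ext x
    simp only [rT, Finset.mem_mul, Finset.mem_image]
    constructor
    · rintro ⟨a, ha, _, ⟨b, hb, rfl⟩, rfl⟩
      exact ⟨a * b, ⟨a, ha, b, hb, rfl⟩, mul_assoc _ _ _⟩
    · rintro ⟨_, ⟨a, ha, b, hb, rfl⟩, rfl⟩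
      exact ⟨a, ha, b * g⁻¹, ⟨b, hb, rfl⟩, (mul_assoc _ _ _).symm⟩
  have hsymm : symmDiff (K * (rT g F).1) (rT g F).1 =
      (symmDiff (K * F.1) F.1).image fun h => h * g⁻¹ := by
    rw [hmul, Finset.image_symmDiff _ _ hinj]
    rfl
  unfold IsInv
  rw [hsymm, Finset.card_image_of_injective _ hinj, card_rT]

variable {V : Type*} [SeminormedAddCommGroup V]

lemma eventuallyInv_norm_le_of_normG_lt {φ : FinG G → V} {ε : ℝ} (h : normG φ < (ε : EReal)) :
    EventuallyInv fun F => ‖φ F‖ ≤ ε * F.1.card := by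
  simp only [normG, limsupG, iInf_lt_iff] at h
  obtain ⟨⟨K, hK⟩, ⟨δ, hδ⟩, h⟩ := h
  refine ⟨K, δ, hK, hδ, fun F hF => ?_⟩
  have hle := (le_iSup (fun F : {F : FinG G // IsInv K δ F.1} =>
    ((‖φ F.1‖ / (F.1.1.card : ℝ) : ℝ) : EReal)) ⟨F, hF⟩).trans h.le
  exact (div_le_iff₀ F.card_pos).1 (EReal.coe_le_coe_iff.1 hle)

lemma normG_le_of_eventuallyInv {φ : FinG G → V} {ε : ℝ}
    (h : EventuallyInv fun F => ‖φ F‖ ≤ ε * F.1.card) : normG φ ≤ (ε : EReal) := by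
  obtain ⟨K, δ, hK, hδ, h⟩ := h
  refine (iInf_le _ ⟨K, hK⟩).trans ((iInf_le _ ⟨δ, hδ⟩).trans (iSup_le fun F => ?_))
  exact EReal.coe_le_coe_iff.2 ((div_le_iff₀ F.1.card_pos).2 (h F.1 F.2))

lemma normG_nonneg (hG : AmenableG G) (φ : FinG G → V) : 0 ≤ normG φ := by
  refine le_iInf fun K => le_iInf fun δ => ?_
  obtain ⟨F, hF, hinv⟩ := hG K.1 K.2 δ.1 δ.2
  refine le_trans ?_ (le_iSup (fun F : {F : FinG G // IsInv K.1 δ.1 F.1} =>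
    ((‖φ F.1‖ / (F.1.1.card : ℝ) : ℝ) : EReal)) ⟨⟨F, hF⟩, hinv⟩)
  exact EReal.coe_nonneg.2 (by positivity)

lemma tendsto_normG_zero (hG : AmenableG G) {φ : ℕ → FinG G → V}
    (h : ∀ ε : ℝ, 0 < ε → ∃ N : ℕ, ∀ n ≥ N, EventuallyInv fun F => ‖φ n F‖ ≤ ε * F.1.card) :
    Tendsto (fun n => normG (φ n)) atTop (nhds (0 : EReal)) := by
  refine tendsto_order.2 ⟨fun a ha => Eventually.of_forall fun n => ha.trans_le (normG_nonneg hG _),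
    fun a ha => ?_⟩
  obtain ⟨ε, hε, hεa⟩ := EReal.lt_iff_exists_real_btwn.1 ha
  obtain ⟨N, hN⟩ := h ε (EReal.coe_pos.1 hε)
  filter_upwards [eventually_ge_atTop N] with n hn
  exact (normG_le_of_eventuallyInv (hN n hn)).trans_lt hεa

lemma norm_sub_le_of_geometric {a : ℕ → V} {c : ℝ} {k m : ℕ} (hkm : k ≤ m) (hc : 0 ≤ c)
    (h : ∀ j < m, ‖a (j + 1) - a j‖ ≤ (1 / 2) ^ j * c) :
    ‖a m - a k‖ ≤ 2 * (1 / 2) ^ k * c := by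
  have key : ‖a m - a k‖ ≤ (2 * (1 / 2) ^ k - 2 * (1 / 2) ^ m) * c := by
    induction m, hkm using Nat.le_induction with
    | base => simp
    | succ m _ ih =>
      have hm := h m m.lt_succ_self
      have hk := ih fun j hj => h j (hj.trans m.lt_succ_self)
      have htri := norm_sub_le_norm_sub_add_norm_sub (a (m + 1)) (a m) (a k)
      rw [pow_succ]
      linarith
  have : 0 ≤ 2 * (1 / 2) ^ m * c := by positivity
  linarith

variable [NormedSpace ℝ V]

lemma exists_limit_of_infinite [Infinite G] (π : G →* (V ≃L[ℝ] V)) {φ : ℕ → FinG G → V}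
    (hφ : ∀ n, MemM π (φ n))
    (hstep : ∀ k, EventuallyInv fun F => ‖φ (k + 1) F - φ k F‖ ≤ (1 / 2) ^ k * F.1.card) :
    ∃ ψ : FinG G → V, MemM π ψ ∧
      ∀ k, EventuallyInv fun F => ‖ψ F - φ k F‖ ≤ 2 * (1 / 2) ^ k * F.1.card := by
  classical
  choose K δ hK hδ hstep using hstep
  let p (F : FinG G) (k : ℕ) : Prop := ∀ j < k, IsInv (K j) (δ j) F.1
  -- The cap by `F.1.card` keeps the index finite even if `F` satisfies every condition.
  let ι (F : FinG G) : ℕ := Nat.findGreatest (p F) F.1.card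
  have hι (F : FinG G) : p F (ι F) :=
    Nat.findGreatest_spec (Nat.zero_le _) fun j hj => absurd hj (Nat.not_lt_zero j)
  have hclose (F : FinG G) (k : ℕ) (hk : k ≤ ι F) :
      ‖φ (ι F) F - φ k F‖ ≤ 2 * (1 / 2) ^ k * F.1.card :=
    norm_sub_le_of_geometric (a := fun j => φ j F) hk F.card_pos.le
      fun j hj => hstep j F (hι F j hj)
  refine ⟨fun F => φ (ι F) F, ⟨?_, fun g F => ?_⟩, fun k => ?_⟩
  · obtain ⟨C, hC⟩ := (hφ 0).1
    refine ⟨C + 2, fun F => ?_⟩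
    have h₀ := hclose F 0 (Nat.zero_le _)
    have htri := norm_le_norm_add_norm_sub' (φ (ι F) F) (φ 0 F)
    have := hC F
    rw [pow_zero] at h₀
    linarith
  · have hιg : ι (rT g F) = ι F := by
      have hp : p (rT g F) = p F := by
        funext k
        simp only [p, isInv_rT]
      simp only [ι, card_rT, hp]
    simp only [hιg]
    exact (hφ _).2 g F
  · have hinv : EventuallyInv fun F => p F k :=
      EventuallyInv.forall_lt (fun j => ⟨K j, δ j, hK j, hδ j, fun F hF => hF⟩) k
    exact (hinv.and (eventuallyInv_le_card k)).mono fun F hF =>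
      hclose F k (Nat.le_findGreatest hF.2 hF.1)

lemma eventuallyInv_iff_univ [Fintype G] {p : FinG G → Prop} :
    EventuallyInv p ↔ p ⟨Finset.univ, Finset.univ_nonempty⟩ := by
  constructor
  · rintro ⟨K, δ, hK, hδ, h⟩
    refine h _ ?_
    have : K * (Finset.univ : Finset G) = Finset.univ := Finset.eq_univ_of_forall fun x => by
      obtain ⟨k, hk⟩ := hK
      exact Finset.mem_mul.2 ⟨k, hk, k⁻¹ * x, Finset.mem_univ _, mul_inv_cancel_left k x⟩
    simp only [IsInv, this, symmDiff_self, Finset.bot_eq_empty, Finset.card_empty, Nat.cast_zero]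
    positivity
  · intro h
    have hcard : (0 : ℝ) < Fintype.card G := Nat.cast_pos.2 Fintype.card_pos
    refine ⟨Finset.univ, 1 / (2 * Fintype.card G), Finset.univ_nonempty, by positivity,
      fun F hF => ?_⟩
    have huniv : (Finset.univ : Finset G) * F.1 = Finset.univ := Finset.eq_univ_of_forall fun x => by
      obtain ⟨f, hf⟩ := F.2
      exact Finset.mem_mul.2 ⟨x * f⁻¹, Finset.mem_univ _, f, hf, inv_mul_cancel_right x f⟩
    have hle : (F.1.card : ℝ) ≤ Fintype.card G := Nat.cast_le.2 F.1.card_le_univ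
    have hlt : ((symmDiff (Finset.univ : Finset G) F.1).card : ℝ) < 1 := by
      unfold IsInv at hF
      rw [huniv] at hF
      refine hF.trans_lt ?_
      rw [one_div_mul_eq_div, div_lt_one (by positivity)]
      linarith
    have hempty : symmDiff (Finset.univ : Finset G) F.1 = ∅ :=
      Finset.card_eq_zero.1 (Nat.lt_one_iff.1 (by exact_mod_cast hlt))
    have hF' : F = ⟨Finset.univ, Finset.univ_nonempty⟩ :=
      Subtype.ext (symmDiff_eq_bot.1 hempty).symm
    exact hF' ▸ h

lemma exists_limit_of_fintype [Fintype G] [CompleteSpace V] (π : G →* (V ≃L[ℝ] V))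
    {φ : ℕ → FinG G → V} (hφ : ∀ n, MemM π (φ n))
    (hcauchy : ∀ ε : ℝ, 0 < ε → ∃ N : ℕ, ∀ m ≥ N, ∀ n ≥ N,
      EventuallyInv fun F => ‖φ m F - φ n F‖ ≤ ε * F.1.card) :
    ∃ ψ : FinG G → V, MemM π ψ ∧ ∀ ε : ℝ, 0 < ε → ∃ N : ℕ, ∀ n ≥ N,
      EventuallyInv fun F => ‖φ n F - ψ F‖ ≤ ε * F.1.card := by
  let U : FinG G := ⟨Finset.univ, Finset.univ_nonempty⟩
  have hcard : (0 : ℝ) < U.1.card := U.card_pos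
  have hseq : CauchySeq fun n => φ n U := by
    refine Metric.cauchySeq_iff.2 fun ε hε => ?_
    obtain ⟨N, hN⟩ := hcauchy (ε / 2 / U.1.card) (by positivity)
    refine ⟨N, fun m hm n hn => ?_⟩
    have hle := eventuallyInv_iff_univ.1 (hN m hm n hn)
    change ‖φ m U - φ n U‖ ≤ ε / 2 / U.1.card * U.1.card at hle
    rw [div_mul_cancel₀ _ hcard.ne'] at hle
    rw [dist_eq_norm]
    linarith
  obtain ⟨v, hv⟩ := cauchySeq_tendsto_of_complete hseq
  -- Limits are not unique in `V`; averaging over `G` makes the limit invariant.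
  let A (w : V) : V := (U.1.card : ℝ)⁻¹ • ∑ g : G, π g w
  have hA : Continuous A := by fun_prop
  have hAinv (g : G) (w : V) : π g (A w) = A w := by
    simp only [A, map_smul, map_sum]
    congr 1
    refine Fintype.sum_equiv (Equiv.mulLeft g) _ _ fun h => ?_
    rw [Equiv.coe_mulLeft, map_mul]
    rfl
  have hU (g : G) : rT g U = U :=
    Subtype.ext (Finset.image_univ_of_surjective (mul_right_surjective g⁻¹))
  have hAφ (n : ℕ) : A (φ n U) = φ n U := by
    have hfix (g : G) : π g (φ n U) = φ n U := by rw [(hφ n).2 g U, hU]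
    simp only [A, hfix, Finset.sum_const]
    rw [← Nat.cast_smul_eq_nsmul ℝ, smul_smul, inv_mul_cancel₀ hcard.ne', one_smul]
  have hlim : Tendsto (fun n => φ n U) atTop (nhds (A v)) := by
    exact ((hA.tendsto v).comp hv).congr hAφ
  classical
  refine ⟨fun F => if F = U then A v else 0, ⟨⟨‖A v‖, fun F => ?_⟩, fun g F => ?_⟩,
    fun ε hε => ?_⟩
  · have hone : (1 : ℝ) ≤ F.1.card := Nat.one_le_cast.2 (Finset.card_pos.2 F.2)
    have hle := le_mul_of_one_le_right (norm_nonneg (A v)) hone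
    dsimp only
    split_ifs
    · exact hle
    · rw [norm_zero]
      positivity
  · have hiff : rT g F = U ↔ F = U := by
      refine Subtype.ext_iff.trans (Iff.trans ?_ Subtype.ext_iff.symm)
      change (rT g F).1 = Finset.univ ↔ F.1 = Finset.univ
      rw [← Finset.card_eq_iff_eq_univ, ← Finset.card_eq_iff_eq_univ, card_rT]
    simp only [hiff]
    split_ifs
    · exact hAinv g v
    · exact map_zero _
  · obtain ⟨N, hN⟩ := Metric.tendsto_atTop.1 hlim (ε * U.1.card) (by positivity)
    refine ⟨N, fun n hn => eventuallyInv_iff_univ.2 ?_⟩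
    have hle := (hN n hn).le
    rw [dist_eq_norm] at hle
    change ‖φ n U - if U = U then A v else 0‖ ≤ ε * U.1.card
    rwa [if_pos rfl]

end Completeness

theorem statement11 {G : Type*} [Group G] [DecidableEq G] [Countable G]
    {V : Type*} [SeminormedAddCommGroup V] [NormedSpace ℝ V] [CompleteSpace V]
    (hG : AmenableG G) (π : G →* (V ≃L[ℝ] V)) (C : ℝ) (hπ : UnifBdd π C) :
    ∀ φ : ℕ → (FinG G → V), (∀ n, MemM π (φ n)) →
      (∀ ε : ℝ, 0 < ε → ∃ N : ℕ, ∀ m ≥ N, ∀ n ≥ N,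
        normG (φ m - φ n) < (ε : EReal)) →
      ∃ ψ : FinG G → V, MemM π ψ ∧
        Filter.Tendsto (fun n => normG (φ n - ψ)) Filter.atTop (nhds (0 : EReal)) := by
  intro φ hφ hcauchy
  replace hcauchy : ∀ ε : ℝ, 0 < ε → ∃ N : ℕ, ∀ m ≥ N, ∀ n ≥ N,
      EventuallyInv fun F => ‖φ m F - φ n F‖ ≤ ε * F.1.card := fun ε hε =>
    (hcauchy ε hε).imp fun N hN m hm n hn => eventuallyInv_norm_le_of_normG_lt (hN m hm n hn)
  suffices h : ∃ ψ : FinG G → V, MemM π ψ ∧ ∀ ε : ℝ, 0 < ε → ∃ N : ℕ, ∀ n ≥ N,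
      EventuallyInv fun F => ‖φ n F - ψ F‖ ≤ ε * F.1.card by
    obtain ⟨ψ, hψ, hlim⟩ := h
    exact ⟨ψ, hψ, tendsto_normG_zero hG hlim⟩
  cases finite_or_infinite G with
  | inl hfin =>
    have := Fintype.ofFinite G
    exact exists_limit_of_fintype π hφ hcauchy
  | inr hinf =>
    choose N hN using fun k : ℕ => hcauchy ((1 / 2) ^ k) (by positivity)
    let n (k : ℕ) : ℕ := ∑ j ∈ Finset.range (k + 1), N j
    have hn {j k : ℕ} (hjk : j ≤ k) : N j ≤ n k :=
      Finset.single_le_sum (fun _ _ => Nat.zero_le _) (Finset.mem_range.2 (by omega))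
    obtain ⟨ψ, hψ, hclose⟩ := exists_limit_of_infinite π (φ := fun k => φ (n k))
      (fun k => hφ _) fun k => hN k _ (hn k.le_succ) _ (hn le_rfl)
    refine ⟨ψ, hψ, fun ε hε => ?_⟩
    obtain ⟨k, hk⟩ := exists_pow_lt_of_lt_one (show 0 < ε / 3 by positivity)
      (show (1 / 2 : ℝ) < 1 by norm_num)
    refine ⟨N k, fun m hm => ((hN k m hm _ (hn le_rfl)).and (hclose k)).mono fun F hF => ?_⟩
    have htri := norm_sub_le_norm_sub_add_norm_sub (φ m F) (φ (n k) F) (ψ F)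
    rw [norm_sub_rev (φ (n k) F)] at htri
    have hmul := mul_le_mul_of_nonneg_right hk.le F.card_pos.le
    have h₁ := hF.1
    have h₂ := hF.2
    linarith
end
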